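/- Let A be a unital C*-algebra equipped with a Lipschitz filtration {A_L}_{L≥0}. If p, q ∈ P^L_n(A) are homotopic in P^L(A), then there exist integers k, l ≥ 0 and a unitary u ∈ U^{1635L}_{n+k+l}(A) such that p ⊕ I_k ⊕ 0_l = u (q ⊕ I_k ⊕ 0_l) u*; moreover u can be chosen so that it is joined to the identity by a norm-continuous path of unitaries inside U^{2087L}_{n+k+l}(A). -/

import Mathlib

open scoped NNReal

/-- Membership in the matrix level `M_n(A)_L` determined by a filtration `lev` of `A`:
`x ∈ M_n(A)_L` iff `ξᵀ x η ∈ A_L` for all vectors `ξ, η ∈ ℂⁿ` of ℓ²-norm at most `1`. -/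
def MatMem {A : Type*} [CStarAlgebra A] (lev : ℝ≥0 → Set A) {n : ℕ}
    (x : Matrix (Fin n) (Fin n) A) (L : ℝ≥0) : Prop :=
  ∀ ξ η : Fin n → ℂ, (∑ i, ‖ξ i‖ ^ 2) ≤ 1 → (∑ j, ‖η j‖ ^ 2) ≤ 1 →
    (∑ i, ∑ j, (ξ i * η j) • x i j) ∈ lev L

/-- A Lipschitz filtration `{A_L}_{L ≥ 0}` on a unital C*-algebra `A`, in the sense of
conditions (L1)–(L6).  The C*-algebras of matrices `M_n(A)` are represented by C*-algebras
`B n` together with ⋆-algebra isomorphisms `φ n : B n ≃⋆ₐ[ℂ] Matrix (Fin n) (Fin n) A`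
(recall that the C*-norm on `M_n(A)` is unique), and the matrix levels `M_n(A)_L` are the sets
`{b : B n | MatMem level (φ n b) L}`. -/
structure LipschitzFiltration (A : Type*) [CStarAlgebra A] (B : ℕ → Type*)
    [∀ n, CStarAlgebra (B n)] (φ : ∀ n, B n ≃⋆ₐ[ℂ] Matrix (Fin n) (Fin n) A) where
  level : ℝ≥0 → Set A
  mono : ∀ ⦃L L' : ℝ≥0⦄, L ≤ L' → level L ⊆ level L'
  dense_union : Dense (⋃ L : ℝ≥0, level L)
  -- (L1)
  closed : ∀ L, IsClosed (level L)
  star_mem : ∀ (L : ℝ≥0) (a : A), a ∈ level L → star a ∈ level L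
  scalar_mem : ∀ (L : ℝ≥0) (c : ℂ), c • (1 : A) ∈ level L
  -- (L2)
  smul_mem : ∀ (L : ℝ≥0) (c : ℂ) (a : A), a ∈ level L → c • a ∈ level (‖c‖₊ * L)
  -- (L3)
  add_mem : ∀ (L₁ L₂ : ℝ≥0) (a₁ a₂ : A), a₁ ∈ level L₁ → a₂ ∈ level L₂ →
    a₁ + a₂ ∈ level (L₁ + L₂)
  -- (L4)
  mul_mem : ∀ (L₁ L₂ : ℝ≥0) (a₁ a₂ : A), a₁ ∈ level L₁ → a₂ ∈ level L₂ →
    a₁ * a₂ ∈ level (‖a₁‖₊ * L₂ + ‖a₂‖₊ * L₁)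
  -- (L5): the matrix levels satisfy (L1)–(L4) in `M_n(A)` and contain all scalar matrices
  mat_closed : ∀ (n : ℕ) (L : ℝ≥0), IsClosed {b : B n | MatMem level (φ n b) L}
  mat_star : ∀ (n : ℕ) (L : ℝ≥0) (b : B n),
    MatMem level (φ n b) L → MatMem level (φ n (star b)) L
  mat_scalar : ∀ (n : ℕ) (L : ℝ≥0) (c : Matrix (Fin n) (Fin n) ℂ),
    MatMem level (c.map (fun z : ℂ => z • (1 : A))) L
  mat_smul : ∀ (n : ℕ) (L : ℝ≥0) (c : ℂ) (b : B n),
    MatMem level (φ n b) L → MatMem level (φ n (c • b)) (‖c‖₊ * L)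
  mat_add : ∀ (n : ℕ) (L₁ L₂ : ℝ≥0) (b₁ b₂ : B n),
    MatMem level (φ n b₁) L₁ → MatMem level (φ n b₂) L₂ →
      MatMem level (φ n (b₁ + b₂)) (L₁ + L₂)
  mat_mul : ∀ (n : ℕ) (L₁ L₂ : ℝ≥0) (b₁ b₂ : B n),
    MatMem level (φ n b₁) L₁ → MatMem level (φ n b₂) L₂ →
      MatMem level (φ n (b₁ * b₂)) (‖b₁‖₊ * L₂ + ‖b₂‖₊ * L₁)
  -- (L6)
  mat_inv : ∀ (n : ℕ) (L : ℝ≥0) (b : B n) (c : ℂ)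
    (h : IsUnit (b - algebraMap ℂ (B n) c)),
    MatMem level (φ n b) L →
      MatMem level (φ n ((↑h.unit⁻¹ : B n))) (‖(↑h.unit⁻¹ : B n)‖₊ ^ 2 * L)

variable {A : Type*} [CStarAlgebra A] {B : ℕ → Type*} [∀ n, CStarAlgebra (B n)]

/-- `p ∈ P^L_n(A)`: `p` is a projection in `M_n(A)_L`. -/
def PMem (φ : ∀ n, B n ≃⋆ₐ[ℂ] Matrix (Fin n) (Fin n) A)
    (𝓕 : LipschitzFiltration A B φ) {n : ℕ} (L : ℝ≥0) (p : B n) : Prop :=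
  MatMem 𝓕.level (φ n p) L ∧ IsSelfAdjoint p ∧ IsIdempotentElem p

/-- `u ∈ U^L_n(A)`: `u` is a unitary in `M_n(A)_L`. -/
def UMem (φ : ∀ n, B n ≃⋆ₐ[ℂ] Matrix (Fin n) (Fin n) A)
    (𝓕 : LipschitzFiltration A B φ) {n : ℕ} (L : ℝ≥0) (u : B n) : Prop :=
  MatMem 𝓕.level (φ n u) L ∧ u ∈ unitary (B n)

/-- Block-diagonal direct sum `x ⊕ y ∈ M_{n+m}(A)`. -/
def oplus (φ : ∀ n, B n ≃⋆ₐ[ℂ] Matrix (Fin n) (Fin n) A)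
    {n m : ℕ} (x : B n) (y : B m) : B (n + m) :=
  (φ (n + m)).symm
    (Matrix.reindex finSumFinEquiv finSumFinEquiv (Matrix.fromBlocks (φ n x) 0 0 (φ m y)))

section CStar

variable {C : Type*} [CStarAlgebra C]

lemma CStarAlgebra.norm_one_le : ‖(1 : C)‖ ≤ 1 := by
  have h : ‖(1 : C)‖ = ‖(1 : C)‖ * ‖(1 : C)‖ := by
    simpa using CStarRing.norm_star_mul_self (x := (1 : C))
  nlinarith [norm_nonneg (1 : C), sq_nonneg (‖(1 : C)‖ - 1)]

lemma CStarAlgebra.norm_le_one_of_star_mul_self {u : C} (h : star u * u = 1) : ‖u‖ ≤ 1 := by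
  have h1 : ‖(1 : C)‖ = ‖u‖ * ‖u‖ := by
    rw [← h]; exact CStarRing.norm_star_mul_self
  nlinarith [norm_nonneg u, CStarAlgebra.norm_one_le (C := C)]

/-- The path `α(t) + β(t) s` from `1` to the symmetry `s`. -/
noncomputable def symmetryPath (s : C) (t : ℝ) : C :=
  ((1 + Complex.exp (Real.pi * t * Complex.I)) / 2) • (1 : C) +
    ((1 - Complex.exp (Real.pi * t * Complex.I)) / 2) • s

lemma continuous_symmetryPath (s : C) : Continuous (symmetryPath s) := by
  unfold symmetryPath; fun_prop

lemma symmetryPath_zero (s : C) : symmetryPath s 0 = 1 := by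
  simp [symmetryPath]

lemma symmetryPath_one (s : C) : symmetryPath s 1 = s := by
  simp [symmetryPath, Complex.exp_pi_mul_I]

lemma symmetryPath_mem_unitary {s : C} (hs : IsSelfAdjoint s) (hss : s * s = 1) (t : ℝ) :
    symmetryPath s t ∈ unitary C := by
  have hz : Complex.exp (Real.pi * t * Complex.I) *
      (starRingEnd ℂ) (Complex.exp (Real.pi * t * Complex.I)) = 1 := by
    rw [Complex.mul_conj, Complex.normSq_eq_norm_sq]
    have := Complex.norm_exp_ofReal_mul_I (Real.pi * t)
    push_cast at this
    simp [this]
  unfold symmetryPath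
  set z := Complex.exp (Real.pi * t * Complex.I)
  have h1 : (1 + starRingEnd ℂ z) / 2 * ((1 + z) / 2)
      + (1 - starRingEnd ℂ z) / 2 * ((1 - z) / 2) = 1 := by
    linear_combination (1 / 2) * hz
  have h2 : (1 + starRingEnd ℂ z) / 2 * ((1 - z) / 2)
      + (1 - starRingEnd ℂ z) / 2 * ((1 + z) / 2) = 0 := by
    linear_combination -(1 / 2) * hz
  have key : ∀ a b c d : ℂ, (a • (1 : C) + b • s) * (c • (1 : C) + d • s) =
      (a * c + b * d) • (1 : C) + (a * d + b * c) • s := by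
    intro a b c d
    simp only [add_mul, mul_add, smul_mul_smul_comm, hss, one_mul, mul_one]
    module
  have hstar : star (((1 + z) / 2) • (1 : C) + ((1 - z) / 2) • s) =
      ((1 + starRingEnd ℂ z) / 2) • (1 : C) + ((1 - starRingEnd ℂ z) / 2) • s := by
    simp [star_smul, hs.star_eq]
  have h3 : (1 + z) / 2 * ((1 + starRingEnd ℂ z) / 2)
      + (1 - z) / 2 * ((1 - starRingEnd ℂ z) / 2) = 1 := by linear_combination h1
  have h4 : (1 + z) / 2 * ((1 - starRingEnd ℂ z) / 2)
      + (1 - z) / 2 * ((1 + starRingEnd ℂ z) / 2) = 0 := by linear_combination h2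
  rw [Unitary.mem_iff, hstar, key, key, h1, h2, h3, h4]
  simp

/-- The fixed point `s = 1 - √(1 - x²)` of `s ↦ (x² + s²) / 2`, inside any closed set stable under
this map on the ball of radius `1/2`. -/
lemma exists_two_smul_eq_sq_add_sq {x : C} (hx : ‖x‖ ≤ 1 / 2) {T : Set C} (hT : IsClosed T)
    (h0 : (0 : C) ∈ T)
    (hF : ∀ s ∈ T, ‖s‖ ≤ 1 / 2 → (2⁻¹ : ℂ) • (x * x + s * s) ∈ T) :
    ∃ s ∈ T, ‖s‖ ≤ 1 / 2 ∧ (2⁻¹ : ℂ) • (x * x + s * s) = s := by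
  let F : C → C := fun s => (2⁻¹ : ℂ) • (x * x + s * s)
  let S : Set C := T ∩ Metric.closedBall 0 (1 / 2)
  have hS : IsComplete S := (hT.inter Metric.isClosed_closedBall).isComplete
  have hmaps : Set.MapsTo F S S := by
    rintro s ⟨hs, hs'⟩
    rw [mem_closedBall_zero_iff] at hs'
    refine ⟨hF s hs hs', ?_⟩
    rw [mem_closedBall_zero_iff]
    have h1 : ‖F s‖ ≤ 2⁻¹ * (‖x‖ * ‖x‖ + ‖s‖ * ‖s‖) := by
      simp only [F, norm_smul]
      have : ‖(2⁻¹ : ℂ)‖ = 2⁻¹ := by simp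
      rw [this]
      gcongr
      exact (norm_add_le _ _).trans (add_le_add (norm_mul_le _ _) (norm_mul_le _ _))
    nlinarith [norm_nonneg x, norm_nonneg s]
  have hcontr : ContractingWith (1 / 2) (hmaps.restrict F S S) := by
    refine ⟨by norm_num, LipschitzWith.of_dist_le_mul ?_⟩
    rintro ⟨s, -, hs⟩ ⟨t, -, ht⟩
    rw [mem_closedBall_zero_iff] at hs ht
    rw [Subtype.dist_eq, Subtype.dist_eq, dist_eq_norm, dist_eq_norm]
    simp only [Set.MapsTo.val_restrict_apply, F]
    rw [← smul_sub, norm_smul]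
    have e : x * x + s * s - (x * x + t * t) = s * (s - t) + (s - t) * t := by noncomm_ring
    have : ‖(2⁻¹ : ℂ)‖ = 2⁻¹ := by simp
    rw [this, e]
    have h1 : ‖s * (s - t) + (s - t) * t‖ ≤ ‖s‖ * ‖s - t‖ + ‖s - t‖ * ‖t‖ :=
      (norm_add_le _ _).trans (add_le_add (norm_mul_le _ _) (norm_mul_le _ _))
    push_cast
    nlinarith [norm_nonneg (s - t)]
  obtain ⟨y, hy, hfix, -⟩ := ContractingWith.exists_fixedPoint' hS hmaps hcontr
    (x := 0) ⟨h0, by simp⟩ (edist_ne_top _ _)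
  exact ⟨y, hy.1, mem_closedBall_zero_iff.1 hy.2, hfix⟩

/-- If `s` is a self-adjoint contraction with `2 s = (p - q)² + s²` commuting with the projections
`p`, `q`, then `(p + q - 1) (s - 1)⁻¹` is a symmetry intertwining `p` and `q`. -/
lemma symmetry_of_close_projections {p q s y : C} (hp : IsSelfAdjoint p) (hpp : p * p = p)
    (hq : IsSelfAdjoint q) (hqq : q * q = q) (hs : IsSelfAdjoint s) (hsp : Commute s p)
    (hsq : Commute s q) (hfix : (2⁻¹ : ℂ) • ((p - q) * (p - q) + s * s) = s)
    (hy : y * (s - 1) = 1) (hy' : (s - 1) * y = 1) :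
    IsSelfAdjoint ((p + q - 1) * y) ∧ ((p + q - 1) * y) * ((p + q - 1) * y) = 1 ∧
      p = ((p + q - 1) * y) * q * ((p + q - 1) * y) := by
  set b := p + q - 1 with hb
  let u : Cˣ := ⟨s - 1, y, hy', hy⟩
  have cinv : ∀ {a : C}, Commute s a → Commute y a := fun {a} h =>
    (Commute.units_inv_left (u := u) (a := a)
      (by simpa [u] using h.sub_left (Commute.one_left a)))
  have hyp : y * p = p * y := cinv hsp
  have hyq : y * q = q * y := cinv hsq
  have hyb : y * b = b * y := cinv ((hsp.add_right hsq).sub_right (Commute.one_right s))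
  have hystar : star y = y := by
    have h1 : (s - 1) * star y = 1 := by
      have := congrArg star hy
      simpa [hs.star_eq] using this
    calc star y = y * (s - 1) * star y := by rw [hy, one_mul]
      _ = y := by rw [mul_assoc, h1, mul_one]
  have hbb : b * b = (s - 1) * (s - 1) := by
    have h2 : (p - q) * (p - q) + s * s = s + s := by
      have := congrArg (fun a => (2 : ℂ) • a) hfix
      simp only [smul_smul] at this
      norm_num at this
      rw [this, two_smul]
    have e1 : b * b = 1 - (p - q) * (p - q) := by
      have : b * b + (p - q) * (p - q) - 1 =
        (p * p - p) + (p * p - p) + (q * q - q) + (q * q - q) := by rw [hb]; noncomm_ring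
      rw [hpp, hqq] at this
      simp only [sub_self, add_zero] at this
      rw [eq_sub_iff_add_eq]; exact sub_eq_zero.1 this
    have e2 : (p - q) * (p - q) = s + s - s * s := eq_sub_of_add_eq h2
    rw [e1, e2]; noncomm_ring
  have hsq1 : (b * y) * (b * y) = 1 := by
    calc (b * y) * (b * y) = b * (y * b) * y := by noncomm_ring
      _ = (b * b) * y * y := by rw [hyb]; noncomm_ring
      _ = (s - 1) * ((s - 1) * y) * y := by rw [hbb]; noncomm_ring
      _ = 1 := by rw [hy', mul_one, hy']
  have hbq : b * q = p * b := by
    simp only [hb, sub_mul, add_mul, mul_sub, mul_add, hpp, hqq]; noncomm_ring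
  refine ⟨?_, hsq1, ?_⟩
  · have : star b = b := by simp [hb, hp.star_eq, hq.star_eq]
    rw [IsSelfAdjoint, star_mul, hystar, this, hyb]
  · calc p = p * ((b * y) * (b * y)) := by rw [hsq1, mul_one]
      _ = (p * b) * y * (b * y) := by noncomm_ring
      _ = b * (q * y) * (b * y) := by rw [← hbq]; noncomm_ring
      _ = (b * y) * q * (b * y) := by rw [← hyq]; noncomm_ring

end CStar

section Level

variable {φ : ∀ n, B n ≃⋆ₐ[ℂ] Matrix (Fin n) (Fin n) A} {𝓕 : LipschitzFiltration A B φ} {n : ℕ}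

lemma LipschitzFiltration.matMem_mono {L L' : ℝ≥0} (h : L ≤ L') {b : Matrix (Fin n) (Fin n) A}
    (hb : MatMem 𝓕.level b L) : MatMem 𝓕.level b L' :=
  fun ξ η hξ hη => 𝓕.mono h (hb ξ η hξ hη)

lemma LipschitzFiltration.matMem_smul_one (c : ℂ) (L : ℝ≥0) :
    MatMem 𝓕.level (φ n (c • (1 : B n))) L := by
  convert 𝓕.mat_scalar n L (c • 1) using 1
  ext i j
  by_cases h : i = j <;> simp [h]

lemma LipschitzFiltration.matMem_one (L : ℝ≥0) : MatMem 𝓕.level (φ n (1 : B n)) L := by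
  simpa only [one_smul] using 𝓕.matMem_smul_one (n := n) 1 L

lemma LipschitzFiltration.matMem_zero (L : ℝ≥0) : MatMem 𝓕.level (φ n (0 : B n)) L := by
  simpa only [zero_smul] using 𝓕.matMem_smul_one (n := n) 0 L

lemma LipschitzFiltration.matMem_neg {L : ℝ≥0} {b : B n} (hb : MatMem 𝓕.level (φ n b) L) :
    MatMem 𝓕.level (φ n (-b)) L := by
  simpa only [neg_smul, one_smul, nnnorm_neg, nnnorm_one, one_mul] using 𝓕.mat_smul n L (-1) b hb

lemma LipschitzFiltration.matMem_sub {L L' : ℝ≥0} {a b : B n} (ha : MatMem 𝓕.level (φ n a) L)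
    (hb : MatMem 𝓕.level (φ n b) L') : MatMem 𝓕.level (φ n (a - b)) (L + L') := by
  rw [sub_eq_add_neg]
  exact 𝓕.mat_add n _ _ _ _ ha (𝓕.matMem_neg hb)

/-- `p` and `q` are conjugate by a unitary of level `c` which is joined to `1` by a path of
unitaries of level `c`. -/
def IsPathConj (𝓕 : LipschitzFiltration A B φ) (c : ℝ≥0) (p q : B n) : Prop :=
  ∃ g : ℝ → B n, Continuous g ∧ g 0 = 1 ∧ (∀ t, UMem φ 𝓕 c (g t)) ∧ p = g 1 * q * star (g 1)

lemma IsPathConj.trans {c d : ℝ≥0} {p q r : B n} (h : IsPathConj 𝓕 c p q)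
    (h' : IsPathConj 𝓕 d q r) : IsPathConj 𝓕 (c + d) p r := by
  obtain ⟨g, hg, hg0, hgu, rfl⟩ := h
  obtain ⟨g', hg', hg0', hgu', rfl⟩ := h'
  refine ⟨fun t => g t * g' t, hg.mul hg', by simp [hg0, hg0'], fun t =>
    ⟨?_, mul_mem (hgu t).2 (hgu' t).2⟩, by simp only [star_mul, mul_assoc]⟩
  refine 𝓕.matMem_mono ?_ (𝓕.mat_mul n _ _ _ _ (hgu t).1 (hgu' t).1)
  have e1 : ‖g t‖₊ ≤ 1 :=
    CStarAlgebra.norm_le_one_of_star_mul_self (Unitary.mem_iff.1 (hgu t).2).1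
  have e2 : ‖g' t‖₊ ≤ 1 :=
    CStarAlgebra.norm_le_one_of_star_mul_self (Unitary.mem_iff.1 (hgu' t).2).1
  calc ‖g t‖₊ * d + ‖g' t‖₊ * c ≤ 1 * d + 1 * c := by gcongr
    _ = c + d := by ring

lemma isPathConj_of_symmetry {c : ℝ≥0} {p q s : B n} (hs : IsSelfAdjoint s) (hss : s * s = 1)
    (hc : MatMem 𝓕.level (φ n s) c) (h : p = s * q * s) : IsPathConj 𝓕 c p q := by
  refine ⟨symmetryPath s, continuous_symmetryPath s, symmetryPath_zero s, fun t =>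
    ⟨?_, symmetryPath_mem_unitary hs hss t⟩, by rw [symmetryPath_one, hs.star_eq, h]⟩
  have hnorm : ‖(1 - Complex.exp (Real.pi * t * Complex.I)) / 2‖₊ ≤ 1 := by
    rw [← NNReal.coe_le_coe, coe_nnnorm, norm_div]
    have := Complex.norm_exp_ofReal_mul_I (Real.pi * t)
    push_cast at this
    have h2 := norm_sub_le (1 : ℂ) (Complex.exp (Real.pi * t * Complex.I))
    rw [this] at h2
    simp only [norm_one] at h2
    simp only [Complex.norm_ofNat, NNReal.coe_one]
    linarith
  refine 𝓕.matMem_mono ?_ (𝓕.mat_add n _ _ _ _ (𝓕.matMem_smul_one _ 0)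
    (𝓕.mat_smul n c _ s hc))
  rw [zero_add]
  exact mul_le_of_le_one_left zero_le hnorm

lemma isPathConj_of_norm_sub_le {L : ℝ≥0} {p q : B n} (hp : PMem φ 𝓕 L p) (hq : PMem φ 𝓕 L q)
    (hpq : ‖p - q‖ ≤ 1 / 2) : IsPathConj 𝓕 (28 * L) p q := by
  obtain ⟨hpL, hpsa, hpp⟩ := hp
  obtain ⟨hqL, hqsa, hqq⟩ := hq
  have hpp : p * p = p := hpp
  have hqq : q * q = q := hqq
  have hxL : MatMem 𝓕.level (φ n (p - q)) (L + L) := 𝓕.matMem_sub hpL hqL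
  have hx2 : (p - q) * (p - q) = p - p * q - q * p + q := by
    simp only [sub_mul, mul_sub, hpp, hqq]; noncomm_ring
  have hxp : Commute ((p - q) * (p - q)) p := by
    rw [Commute, SemiconjBy, hx2]
    simp only [sub_mul, add_mul, mul_sub, mul_add, ← mul_assoc, hpp]
    simp only [mul_assoc, hpp]
    noncomm_ring
  have hxq : Commute ((p - q) * (p - q)) q := by
    rw [Commute, SemiconjBy, hx2]
    simp only [sub_mul, add_mul, mul_sub, mul_add, ← mul_assoc, hqq]
    simp only [mul_assoc, hqq]
    noncomm_ring
  let T : Set (B n) := {s | MatMem 𝓕.level (φ n s) (2 * L)} ∩ {s | star s = s} ∩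
    {s | s * p = p * s} ∩ {s | s * q = q * s}
  have hT : IsClosed T :=
    (((𝓕.mat_closed n (2 * L)).inter (isClosed_eq continuous_star continuous_id)).inter
      (isClosed_eq (by fun_prop) (by fun_prop))).inter (isClosed_eq (by fun_prop) (by fun_prop))
  obtain ⟨s, ⟨⟨⟨hsL, hsa⟩, hsp⟩, hsq⟩, hs, hfix⟩ :=
    exists_two_smul_eq_sq_add_sq hpq hT
      ⟨⟨⟨𝓕.matMem_zero _, star_zero _⟩, by simp⟩, by simp⟩ (by
      rintro s ⟨⟨⟨hsL, hsa⟩, hsp⟩, hsq⟩ hs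
      have hsp : Commute s p := hsp
      have hsq : Commute s q := hsq
      have hsa : star s = s := hsa
      refine ⟨⟨⟨?_, ?_⟩, ?_⟩, ?_⟩
      · refine 𝓕.matMem_mono ?_ (𝓕.mat_smul n _ (2⁻¹) _ (𝓕.mat_add n _ _ _ _
          (𝓕.mat_mul n _ _ _ _ hxL hxL) (𝓕.mat_mul n _ _ _ _ hsL hsL)))
        rw [← NNReal.coe_le_coe]
        push_cast
        have : ‖(2⁻¹ : ℂ)‖ = 2⁻¹ := by simp
        rw [this]
        have hL : (0 : ℝ) ≤ L := L.2
        have h1 := mul_le_mul_of_nonneg_right hpq hL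
        have h2 := mul_le_mul_of_nonneg_right hs hL
        linarith
      · simp [star_smul, hpsa.star_eq, hqsa.star_eq, hsa]
      · exact ((hxp.add_left (hsp.mul_left hsp)).smul_left _).eq
      · exact ((hxq.add_left (hsq.mul_left hsq)).smul_left _).eq)
  have hunit : IsUnit (s - algebraMap ℂ (B n) 1) := by
    rw [map_one, ← neg_sub]
    exact (isUnit_one_sub_of_norm_lt_one (by linarith)).neg
  have hyL := 𝓕.mat_inv n _ s 1 hunit hsL
  set y : B n := ↑hunit.unit⁻¹ with hydef
  have hy : y * (s - algebraMap ℂ (B n) 1) = 1 := hunit.val_inv_mul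
  have hy' : (s - algebraMap ℂ (B n) 1) * y = 1 := hunit.mul_val_inv
  rw [map_one] at hy hy'
  have hynorm : ‖y‖ ≤ 2 := by
    have e : y = y * s - 1 := by rw [← hy]; noncomm_ring
    have h1 : ‖y‖ ≤ ‖y‖ * ‖s‖ + ‖(1 : B n)‖ := by
      conv_lhs => rw [e]
      exact (norm_sub_le _ _).trans (add_le_add_left (norm_mul_le _ _) _)
    nlinarith [norm_nonneg y, CStarAlgebra.norm_one_le (C := B n)]
  obtain ⟨h1, h2, h3⟩ :=
    symmetry_of_close_projections hpsa hpp hqsa hqq hsa hsp hsq hfix hy hy'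
  refine isPathConj_of_symmetry h1 h2 ?_ h3
  have hpn : ‖p‖ ≤ 1 := by
    have h := CStarRing.norm_star_mul_self (x := p)
    rw [hpsa.star_eq, hpp] at h
    nlinarith [norm_nonneg p, sq_nonneg (‖p‖ - 1)]
  have hbn : ‖p + q - 1‖ ≤ 3 := by
    have hqn : ‖q‖ ≤ 1 := by
      have h := CStarRing.norm_star_mul_self (x := q)
      rw [hqsa.star_eq, hqq] at h
      nlinarith [norm_nonneg q, sq_nonneg (‖q‖ - 1)]
    have := norm_sub_le (p + q) 1
    have := norm_add_le p q
    linarith [CStarAlgebra.norm_one_le (C := B n)]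
  have hbL := 𝓕.matMem_sub (𝓕.mat_add n _ _ _ _ hpL hqL) (𝓕.matMem_one (n := n) 0)
  refine 𝓕.matMem_mono ?_ (𝓕.mat_mul n _ _ _ _ hbL hyL)
  have hbn' : ‖p + q - 1‖₊ ≤ 3 := hbn
  have hyn' : ‖y‖₊ ≤ 2 := hynorm
  calc ‖p + q - 1‖₊ * (‖y‖₊ ^ 2 * (2 * L)) + ‖y‖₊ * (L + L + 0)
      ≤ 3 * (2 ^ 2 * (2 * L)) + 2 * (L + L + 0) := by gcongr
    _ = 28 * L := by ring

end Level

section Blocks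

variable {φ : ∀ n, B n ≃⋆ₐ[ℂ] Matrix (Fin n) (Fin n) A} {𝓕 : LipschitzFiltration A B φ}
  {r N : ℕ} {K : Type*} [DecidableEq K]

/-- The permutation matrix exchanging blocks according to `τ`. -/
noncomputable def blockPerm (φ : ∀ n, B n ≃⋆ₐ[ℂ] Matrix (Fin n) (Fin n) A)
    (e : Fin r × K ≃ Fin N) (τ : K → K) : B N :=
  (φ N).symm (((1 : Matrix (Fin r × K) (Fin r × K) A).submatrix (Prod.map id τ) id).submatrix
    e.symm e.symm)

lemma apply_blockPerm (e : Fin r × K ≃ Fin N) (τ : K → K) :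
    φ N (blockPerm φ e τ) =
      ((1 : Matrix (Fin r × K) (Fin r × K) A).submatrix (Prod.map id τ) id).submatrix
        e.symm e.symm :=
  (φ N).apply_symm_apply _

variable {e : Fin r × K ≃ Fin N} {τ : K → K}

lemma matMem_blockPerm (L : ℝ≥0) : MatMem 𝓕.level (φ N (blockPerm φ e τ)) L := by
  convert 𝓕.mat_scalar N L (((1 : Matrix (Fin r × K) (Fin r × K) ℂ).submatrix
    (Prod.map id τ) id).submatrix e.symm e.symm) using 1
  rw [apply_blockPerm]
  ext i j
  simp only [Matrix.submatrix_apply, Matrix.map_apply, Matrix.one_apply]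
  split_ifs <;> simp

lemma isSelfAdjoint_blockPerm (hτ : Function.Involutive τ) :
    IsSelfAdjoint (blockPerm φ e τ) := by
  apply EquivLike.injective (φ N)
  rw [map_star, apply_blockPerm, Matrix.star_eq_conjTranspose, Matrix.conjTranspose_submatrix]
  congr 1
  ext ⟨i, k⟩ ⟨j, l⟩
  have : (i = j ∧ τ k = l) ↔ (j = i ∧ τ l = k) := by
    constructor
    · rintro ⟨rfl, rfl⟩; exact ⟨rfl, hτ k⟩
    · rintro ⟨rfl, rfl⟩; exact ⟨rfl, hτ l⟩
  simp [Matrix.one_apply, this]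
  split_ifs <;> simp

variable [Fintype K]

/-- The block-diagonal embedding of families of `r × r` matrices into `N × N` matrices. -/
noncomputable def blockDiag (φ : ∀ n, B n ≃⋆ₐ[ℂ] Matrix (Fin n) (Fin n) A)
    (e : Fin r × K ≃ Fin N) : (K → B r) →⋆ₙₐ[ℂ] B N where
  toFun f := (φ N).symm ((Matrix.blockDiagonal fun k => φ r (f k)).submatrix e.symm e.symm)
  map_smul' c f := by
    rw [MonoidHom.id_apply, ← map_smul]
    congr 1
    ext i j
    simp [Matrix.blockDiagonal_apply]
  map_zero' := by
    rw [← map_zero (φ N).symm]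
    congr 1
    ext i j
    simp [Matrix.blockDiagonal_apply]
  map_add' f g := by
    rw [← map_add, ← Pi.add_apply, ← Pi.add_apply, ← Matrix.submatrix_add,
      ← Matrix.blockDiagonal_add]
    simp only [Pi.add_apply, map_add]
    rfl
  map_mul' f g := by
    rw [← map_mul, Matrix.submatrix_mul_equiv, ← Matrix.blockDiagonal_mul]
    simp only [Pi.mul_apply, map_mul]
  map_star' f := by
    rw [← map_star, Matrix.star_eq_conjTranspose, Matrix.conjTranspose_submatrix,
      Matrix.blockDiagonal_conjTranspose]
    simp only [Pi.star_apply, map_star, Matrix.star_eq_conjTranspose]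

lemma apply_blockDiag (e : Fin r × K ≃ Fin N) (f : K → B r) :
    φ N (blockDiag φ e f) =
      (Matrix.blockDiagonal fun k => φ r (f k)).submatrix e.symm e.symm :=
  (φ N).apply_symm_apply _

lemma blockDiag_one (e : Fin r × K ≃ Fin N) : blockDiag φ e (1 : K → B r) = 1 := by
  apply EquivLike.injective (φ N)
  rw [apply_blockDiag]
  simp only [Pi.one_apply, map_one]
  exact (congrArg (fun M => Matrix.submatrix M e.symm e.symm)
    (Matrix.blockDiagonal_one (o := K) (m := Fin r) (α := A))).trans
    (Matrix.submatrix_one_equiv e.symm)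

lemma Matrix.one_submatrix_prodMap_mul (M : Matrix (Fin r × K) (Fin r × K) A) :
    (1 : Matrix (Fin r × K) (Fin r × K) A).submatrix (Prod.map id τ) id * M =
      M.submatrix (Prod.map id τ) id :=
  Matrix.one_submatrix_mul _ (Equiv.refl _) M

lemma Matrix.mul_one_submatrix_prodMap (hτ : Function.Involutive τ)
    (M : Matrix (Fin r × K) (Fin r × K) A) :
    M * (1 : Matrix (Fin r × K) (Fin r × K) A).submatrix (Prod.map id τ) id =
      M.submatrix id (Prod.map id τ) :=
  Matrix.mul_submatrix_one ((Equiv.refl _).prodCongr hτ.toPerm) id M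

lemma blockPerm_mul_self (hτ : Function.Involutive τ) :
    blockPerm φ e τ * blockPerm φ e τ = 1 := by
  apply EquivLike.injective (φ N)
  rw [map_mul, apply_blockPerm, Matrix.submatrix_mul_equiv, map_one,
    Matrix.one_submatrix_prodMap_mul]
  have : Prod.map (id : Fin r → Fin r) τ ∘ Prod.map id τ = id := by
    ext ⟨i, k⟩ <;> simp [hτ k]
  rw [Matrix.submatrix_submatrix 1, this, Function.comp_id, Matrix.submatrix_id_id]
  exact Matrix.submatrix_one_equiv e.symm

lemma blockPerm_mul_blockDiag (hτ : Function.Involutive τ) (f : K → B r) :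
    blockPerm φ e τ * blockDiag φ e f = blockDiag φ e (f ∘ τ) * blockPerm φ e τ := by
  apply EquivLike.injective (φ N)
  rw [map_mul, map_mul, apply_blockPerm, apply_blockDiag, apply_blockDiag,
    Matrix.submatrix_mul_equiv, Matrix.submatrix_mul_equiv]
  rw [Matrix.one_submatrix_prodMap_mul, Matrix.mul_one_submatrix_prodMap hτ]
  congr 1
  ext ⟨i, k⟩ ⟨j, l⟩
  have hkl : τ k = l ↔ k = τ l := ⟨fun h => by rw [← h, hτ], fun h => by rw [h, hτ]⟩
  simp [Matrix.blockDiagonal_apply, hkl]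

lemma LipschitzFiltration.matMem_scaled {L a b : ℝ≥0} {x : Matrix (Fin r) (Fin r) A}
    (hx : MatMem 𝓕.level x L) (ξ η : Fin r → ℂ) (hξ : ∑ i, ‖ξ i‖ ^ 2 = (a : ℝ) ^ 2)
    (hη : ∑ i, ‖η i‖ ^ 2 = (b : ℝ) ^ 2) :
    (∑ i, ∑ j, (ξ i * η j) • x i j) ∈ 𝓕.level (a * b * L) := by
  have hzero : (0 : A) ∈ 𝓕.level (a * b * L) := by
    simpa only [zero_smul] using 𝓕.scalar_mem (a * b * L) 0
  have hvanish : ∀ ζ : Fin r → ℂ, ∑ i, ‖ζ i‖ ^ 2 = 0 → ∀ i, ζ i = 0 := by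
    intro ζ h i
    have := (Finset.sum_eq_zero_iff_of_nonneg (fun i _ => sq_nonneg ‖ζ i‖)).1 h i
      (Finset.mem_univ i)
    simpa using this
  have hscale : ∀ (ζ : Fin r → ℂ) (c : ℝ≥0), c ≠ 0 → ∑ i, ‖ζ i‖ ^ 2 = (c : ℝ) ^ 2 →
      ∑ i, ‖((c : ℝ) : ℂ)⁻¹ * ζ i‖ ^ 2 ≤ 1 := by
    intro ζ c hc h
    have hc' : (c : ℝ) ≠ 0 := by exact_mod_cast hc
    simp only [norm_mul, mul_pow, ← Finset.mul_sum, h, norm_inv, Complex.norm_real,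
      NNReal.norm_eq]
    rw [← mul_pow, inv_mul_cancel₀ hc', one_pow]
  by_cases ha : a = 0
  · have := hvanish ξ (by simp [hξ, ha])
    simpa [this] using hzero
  by_cases hb : b = 0
  · have := hvanish η (by simp [hη, hb])
    simpa [this] using hzero
  have ha' : ((a : ℝ) : ℂ) ≠ 0 := by exact_mod_cast ha
  have hb' : ((b : ℝ) : ℂ) ≠ 0 := by exact_mod_cast hb
  have h := 𝓕.smul_mem L (((a : ℝ) : ℂ) * ((b : ℝ) : ℂ)) _
    (hx _ _ (hscale ξ a ha hξ) (hscale η b hb hη))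
  have e1 : ((a : ℝ) : ℂ) * ((b : ℝ) : ℂ) ≠ 0 := mul_ne_zero ha' hb'
  have e2 : ‖((a : ℝ) : ℂ) * ((b : ℝ) : ℂ)‖₊ = a * b := by
    rw [← NNReal.coe_inj]
    simp
  rw [e2] at h
  convert h using 1
  simp only [Finset.smul_sum, smul_smul]
  refine Finset.sum_congr rfl fun i _ => Finset.sum_congr rfl fun j _ => ?_
  congr 1
  field_simp

lemma LipschitzFiltration.sum_mem (c : K → ℝ≥0) (a : K → A) (h : ∀ k, a k ∈ 𝓕.level (c k)) :
    ∑ k, a k ∈ 𝓕.level (∑ k, c k) := by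
  have : ∀ s : Finset K, ∑ k ∈ s, a k ∈ 𝓕.level (∑ k ∈ s, c k) := by
    intro s
    induction s using Finset.induction_on with
    | empty => simpa only [zero_smul, Finset.sum_empty] using 𝓕.scalar_mem 0 0
    | insert k s hk ih =>
      rw [Finset.sum_insert hk, Finset.sum_insert hk]
      exact 𝓕.add_mem _ _ _ _ (h k) ih
  exact this _

lemma matMem_blockDiag {L : ℝ≥0} {f : K → B r}
    (hf : ∀ k, MatMem 𝓕.level (φ r (f k)) L) :
    MatMem 𝓕.level (φ N (blockDiag φ e f)) L := by
  intro ξ η hξ hη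
  let nrm : (Fin N → ℂ) → K → ℝ≥0 := fun ζ k => NNReal.sqrt (∑ i, ‖ζ (e (i, k))‖₊ ^ 2)
  have hnrm : ∀ ζ k, ∑ i, ‖ζ (e (i, k))‖ ^ 2 = (nrm ζ k : ℝ) ^ 2 := by
    intro ζ k
    have : nrm ζ k ^ 2 = ∑ i, ‖ζ (e (i, k))‖₊ ^ 2 := NNReal.sq_sqrt _
    rw [← NNReal.coe_pow, this]
    push_cast
    rfl
  have hnrm1 : ∀ ζ : Fin N → ℂ, ∑ i, ‖ζ i‖ ^ 2 ≤ 1 → ∑ k, nrm ζ k ^ 2 ≤ 1 := by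
    intro ζ h
    rw [← NNReal.coe_le_coe]
    push_cast
    simp only [← hnrm]
    rwa [Finset.sum_comm, ← Fintype.sum_prod_type (fun z : Fin r × K => ‖ζ (e z)‖ ^ 2),
      e.sum_comp (fun i => ‖ζ i‖ ^ 2)]
  have hcs : ∑ k, nrm ξ k * nrm η k ≤ 1 := by
    have h := Finset.sum_mul_sq_le_sq_mul_sq Finset.univ (nrm ξ) (nrm η)
    have h1 : (∑ k, nrm ξ k * nrm η k) ^ 2 ≤ 1 :=
      h.trans (mul_le_one' (hnrm1 ξ hξ) (hnrm1 η hη))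
    exact (pow_le_one_iff two_ne_zero).1 h1
  have hsum : ∑ i, ∑ j, (ξ i * η j) • φ N (blockDiag φ e f) i j =
      ∑ k, ∑ i, ∑ j, (ξ (e (i, k)) * η (e (j, k))) • φ r (f k) i j := by
    rw [apply_blockDiag, ← e.sum_comp, Fintype.sum_prod_type, Finset.sum_comm]
    refine Finset.sum_congr rfl fun k _ => Finset.sum_congr rfl fun i _ => ?_
    rw [← e.sum_comp, Fintype.sum_prod_type]
    refine Finset.sum_congr rfl fun j _ => ?_
    rw [Finset.sum_eq_single k]
    · simp [Matrix.blockDiagonal_apply]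
    · intro l _ hl
      simp [Matrix.blockDiagonal_apply, hl.symm]
    · simp
  rw [hsum]
  refine 𝓕.mono ?_ (𝓕.sum_mem _ _ fun k =>
    𝓕.matMem_scaled (hf k) _ _ (hnrm ξ k) (hnrm η k))
  rw [← Finset.sum_mul]
  exact mul_le_of_le_one_left zero_le hcs

end Blocks

section Swindle

lemma swap_conj {R : Type*} [Ring R] {d w f g : R} (hd : d * d = d) (hw : w * w = 1)
    (hwd : w * d = d * w) (hfd : f * d = d * f) (hgd : g * d = d * g) (hwf : w * f = g * w) :
    (1 + d * (w - 1)) * f * (1 + d * (w - 1)) = (1 - d) * f + d * g := by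
  have e1 : d * w * f * d * w = d * g := by
    calc d * w * f * d * w = d * (w * f) * d * w := by noncomm_ring
      _ = d * g * (w * d) * w := by rw [hwf]; noncomm_ring
      _ = d * (g * d) * (w * w) := by rw [hwd]; noncomm_ring
      _ = (d * d) * g := by rw [hgd, hw]; noncomm_ring
      _ = d * g := by rw [hd]
  have e2 : f * d * w = d * f * w := by rw [hfd]
  have e3 : d * f * d = d * f := by rw [mul_assoc, hfd, ← mul_assoc, hd]
  have e4 : d * w * f * d = d * w * f := by
    calc d * w * f * d = d * (w * f) * d := by noncomm_ring
      _ = d * g * (w * d) := by rw [hwf]; noncomm_ring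
      _ = d * (g * d) * w := by rw [hwd]; noncomm_ring
      _ = (d * d) * (g * w) := by rw [hgd]; noncomm_ring
      _ = d * w * f := by rw [hd, ← hwf, mul_assoc]
  have : (1 + d * (w - 1)) * f * (1 + d * (w - 1)) =
      f + f * d * w - f * d + d * w * f + d * w * f * d * w - d * w * f * d
        - d * f - d * f * d * w + d * f * d := by noncomm_ring
  rw [this, e1, e2, e3, e4, hfd]
  noncomm_ring

variable {φ : ∀ n, B n ≃⋆ₐ[ℂ] Matrix (Fin n) (Fin n) A} {𝓕 : LipschitzFiltration A B φ}
  {n r N m : ℕ} {K : Type*} [DecidableEq K] [Fintype K] {e : Fin r × K ≃ Fin N} {L : ℝ≥0}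

lemma IsPathConj.symm {c : ℝ≥0} {p q : B n} (h : IsPathConj 𝓕 c p q) : IsPathConj 𝓕 c q p := by
  obtain ⟨g, hg, hg0, hgu, rfl⟩ := h
  refine ⟨fun t => star (g t), hg.star, by simp [hg0], fun t =>
    ⟨𝓕.mat_star n _ _ (hgu t).1, Unitary.star_mem (hgu t).2⟩, ?_⟩
  have h := (Unitary.mem_iff.1 (hgu 1).2).1
  calc q = (star (g 1) * g 1) * q * (star (g 1) * g 1) := by rw [h, one_mul, mul_one]
    _ = _ := by simp only [star_star, mul_assoc]

lemma PMem.one_sub {p : B n} (h : PMem φ 𝓕 L p) : PMem φ 𝓕 L (1 - p) :=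
  ⟨by simpa using 𝓕.matMem_sub (𝓕.matMem_one 0) h.1, (IsSelfAdjoint.one _).sub h.2.1,
    h.2.2.one_sub⟩

lemma pMem_blockDiag {f : K → B r} (hf : ∀ k, PMem φ 𝓕 L (f k)) :
    PMem φ 𝓕 L (blockDiag φ e f) := by
  refine ⟨matMem_blockDiag fun k => (hf k).1, ?_, ?_⟩
  · rw [IsSelfAdjoint, ← map_star]
    exact congrArg _ (funext fun k => (hf k).2.1)
  · rw [IsIdempotentElem, ← map_mul]
    exact congrArg _ (funext fun k => (hf k).2.2)

lemma isPathConj_blockDiag_swap {τ : K → K} (hτ : Function.Involutive τ) {d f f' : K → B r}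
    (hd : ∀ k, PMem φ 𝓕 L (d k)) (hdτ : ∀ k, d (τ k) = d k) (hfd : ∀ k, f k * d k = d k * f k)
    (hf' : ∀ k, f' k = (1 - d k) * f k + d k * f (τ k)) :
    IsPathConj 𝓕 (2 * L) (blockDiag φ e f') (blockDiag φ e f) := by
  obtain ⟨hDL, hDsa, hDD⟩ := pMem_blockDiag (e := e) hd
  have hw := blockPerm_mul_self (φ := φ) (e := e) hτ
  have hwsa := isSelfAdjoint_blockPerm (φ := φ) (e := e) hτ
  have hwf := blockPerm_mul_blockDiag (φ := φ) (e := e) hτ f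
  have hwd := blockPerm_mul_blockDiag (φ := φ) (e := e) hτ d
  rw [show d ∘ τ = d from funext hdτ] at hwd
  have hFD : blockDiag φ e f * blockDiag φ e d = blockDiag φ e d * blockDiag φ e f := by
    rw [← map_mul, ← map_mul]
    exact congrArg _ (funext hfd)
  have hGD : blockDiag φ e (f ∘ τ) * blockDiag φ e d =
      blockDiag φ e d * blockDiag φ e (f ∘ τ) := by
    rw [← map_mul, ← map_mul]
    refine congrArg _ (funext fun k => ?_)
    simpa [hdτ] using hfd (τ k)
  have hF' : blockDiag φ e f' =
      (1 - blockDiag φ e d) * blockDiag φ e f + blockDiag φ e d * blockDiag φ e (f ∘ τ) := by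
    rw [← blockDiag_one (φ := φ) e, ← map_sub, ← map_mul, ← map_mul, ← map_add]
    exact congrArg _ (funext hf')
  have hwL := matMem_blockPerm (𝓕 := 𝓕) (e := e) (τ := τ) 0
  set D := blockDiag φ e d
  set W := blockPerm φ e τ
  refine isPathConj_of_symmetry (s := 1 + D * (W - 1)) ?_ ?_ ?_ ?_
  · rw [IsSelfAdjoint, star_add, star_one, star_mul, star_sub, star_one, hDsa.star_eq,
      hwsa.star_eq, sub_mul, hwd, one_mul, mul_sub, mul_one]
  · simpa using swap_conj hDD hw hwd (f := 1) (g := 1) (by simp) (by simp) (by simp)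
  · have hWn : ‖W - 1‖₊ ≤ 2 := by
      have h1 : ‖W‖ ≤ 1 :=
        CStarAlgebra.norm_le_one_of_star_mul_self (by rw [hwsa.star_eq, hw])
      have h2 : ‖W - 1‖ ≤ 2 := by
        linarith [norm_sub_le W 1, CStarAlgebra.norm_one_le (C := B N)]
      exact h2
    refine 𝓕.matMem_mono ?_ (𝓕.mat_add N _ _ _ _ (𝓕.matMem_one 0) (𝓕.mat_mul N _ _ _ _ hDL
      (𝓕.matMem_sub hwL (𝓕.matMem_one 0))))
    calc 0 + (‖D‖₊ * (0 + 0) + ‖W - 1‖₊ * L) = ‖W - 1‖₊ * L := by ring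
      _ ≤ 2 * L := by gcongr
  · rw [hF', swap_conj hDD hw hwd hFD hGD hwf]

/-- The family of blocks `(x, 0, …, 0; 1, …, 1)`. -/
def stabBlocks {R : Type*} [Zero R] [One R] (m : ℕ) (x : R) : Fin (m + 1) ⊕ Fin m → R :=
  Sum.elim (Fin.cons x 0) 1

/-- A chain of close projections yields a conjugacy of the stabilized endpoints whose level does
not depend on the length of the chain. -/
lemma isPathConj_stabBlocks {e : Fin r × (Fin (m + 1) ⊕ Fin m) ≃ Fin N} {P : Fin (m + 1) → B r}
    (hP : ∀ i, PMem φ 𝓕 L (P i)) (hclose : ∀ i : Fin m, ‖P i.castSucc - P i.succ‖ ≤ 1 / 2) :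
    IsPathConj 𝓕 (34 * L) (blockDiag φ e (stabBlocks m (P 0)))
      (blockDiag φ e (stabBlocks m (P (Fin.last m)))) := by
  have idem : ∀ i, P i * P i = P i := fun i => (hP i).2.2
  have h1 : IsPathConj 𝓕 (2 * L) (blockDiag φ e (Sum.elim P fun i => 1 - P i.succ))
      (blockDiag φ e (stabBlocks m (P 0))) := by
    refine isPathConj_blockDiag_swap
      (τ := Sum.elim (Fin.cons (Sum.inl 0) Sum.inr) (Sum.inl ∘ Fin.succ))
      (d := Sum.elim P (P ∘ Fin.succ)) ?_ ?_ ?_ ?_ ?_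
    · rintro (k | k)
      · cases k using Fin.cases <;> simp
      · simp
    · rintro (k | k) <;> exact hP _
    · rintro (k | k)
      · cases k using Fin.cases <;> simp
      · simp
    · rintro (k | k)
      · cases k using Fin.cases <;> simp [stabBlocks]
      · simp [stabBlocks]
    · rintro (k | k)
      · cases k using Fin.cases <;> simp [stabBlocks, sub_mul, idem]
      · simp [stabBlocks]
  have h2 : IsPathConj 𝓕 (28 * L) (blockDiag φ e (Sum.elim P fun i => 1 - P i.succ))
      (blockDiag φ e (Sum.elim P fun i => 1 - P i.castSucc)) := by
    refine isPathConj_of_norm_sub_le (pMem_blockDiag ?_) (pMem_blockDiag ?_) ?_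
    · rintro (k | k)
      exacts [hP k, (hP _).one_sub]
    · rintro (k | k)
      exacts [hP k, (hP _).one_sub]
    · rw [← map_sub]
      refine (NonUnitalStarAlgHom.norm_apply_le (blockDiag φ e) _).trans ?_
      rw [pi_norm_le_iff_of_nonneg (by norm_num)]
      rintro (k | k)
      · simp
      · simpa using hclose k
  have h3 : IsPathConj 𝓕 (2 * L) (blockDiag φ e (Sum.elim P fun i => 1 - P i.castSucc))
      (blockDiag φ e (Sum.elim (Fin.snoc (α := fun _ => B r) 0 (P (Fin.last m))) 1)) := by
    refine isPathConj_blockDiag_swap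
      (τ := Sum.elim (Fin.snoc (α := fun _ => Fin (m + 1) ⊕ Fin m) Sum.inr
        (Sum.inl (Fin.last m))) (Sum.inl ∘ Fin.castSucc))
      (d := Sum.elim P (P ∘ Fin.castSucc)) ?_ ?_ ?_ ?_ ?_
    · rintro (k | k)
      · cases k using Fin.lastCases <;> simp
      · simp
    · rintro (k | k) <;> exact hP _
    · rintro (k | k)
      · cases k using Fin.lastCases <;> simp
      · simp
    · rintro (k | k)
      · cases k using Fin.lastCases <;> simp
      · simp
    · rintro (k | k)
      · cases k using Fin.lastCases <;> simp [sub_mul, idem]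
      · simp
  have h4 : IsPathConj 𝓕 (2 * L)
      (blockDiag φ e (Sum.elim (Fin.snoc (α := fun _ => B r) 0 (P (Fin.last m))) 1))
      (blockDiag φ e (stabBlocks m (P (Fin.last m)))) := by
    refine isPathConj_blockDiag_swap (τ := Sum.map (Equiv.swap 0 (Fin.last m)) id)
      (d := 1) ?_ ?_ ?_ ?_ ?_
    · rintro (k | k) <;> simp
    · exact fun k => ⟨𝓕.matMem_one L, IsSelfAdjoint.one _, IsIdempotentElem.one⟩
    · simp
    · simp
    · rintro (k | k)
      · cases k using Fin.lastCases with
        | last => simp [stabBlocks]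
        | cast k =>
          have h0 : Equiv.swap 0 (Fin.last m) k.castSucc ≠ 0 := by
            intro h
            rw [Equiv.swap_apply_eq_iff, Equiv.swap_apply_left] at h
            exact (Fin.castSucc_lt_last k).ne h
          obtain ⟨l, hl⟩ := Fin.exists_succ_eq.2 h0
          simp [stabBlocks, ← hl]
      · simp [stabBlocks]
  have h := ((h1.symm.trans h2).trans h3).trans h4
  rwa [show 2 * L + 28 * L + 2 * L + 2 * L = 34 * L by ring] at h

lemma apply_oplus {k : ℕ} (x : B n) (y : B k) (a b : Fin n ⊕ Fin k) :
    φ (n + k) (oplus φ x y) (finSumFinEquiv a) (finSumFinEquiv b) =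
      Matrix.fromBlocks (φ n x) 0 0 (φ k y) a b := by
  rw [oplus, (φ (n + k)).apply_symm_apply]
  simp

/-- An enumeration of the `(2m + 1)` blocks of size `n + j` bringing
`(x ⊕ 0, 0, …, 0; 1, …, 1)` to the form `x ⊕ 1 ⊕ 0`. -/
lemma exists_blockDiag_stabBlocks_eq (φ : ∀ n, B n ≃⋆ₐ[ℂ] Matrix (Fin n) (Fin n) A)
    (n j m : ℕ) :
    ∃ (k l : ℕ) (e : Fin (n + j) × (Fin (m + 1) ⊕ Fin m) ≃ Fin (n + k + l)), ∀ x : B n,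
      blockDiag φ e (stabBlocks m (oplus φ x (0 : B j))) =
        oplus φ (oplus φ x (1 : B k)) (0 : B l) := by
  obtain ⟨G⟩ : Nonempty (Fin (n + j) × Fin m ≃ Fin ((n + j) * m)) := ⟨finProdFinEquiv⟩
  let E : (Fin n ⊕ Fin ((n + j) * m)) ⊕ Fin (j + (n + j) * m) →
      Fin (n + j) × (Fin (m + 1) ⊕ Fin m) :=
    Sum.elim (Sum.elim (fun i => (Fin.castAdd j i, Sum.inl 0))
      fun z => Prod.map id Sum.inr (G.symm z))
      fun z => Sum.elim (fun i => (Fin.natAdd n i, Sum.inl 0))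
        (fun z => Prod.map id (Sum.inl ∘ Fin.succ) (G.symm z))
        (finSumFinEquiv.symm z)
  have hE : Function.Bijective E := by
    rw [Fintype.bijective_iff_surjective_and_card]
    refine ⟨?_, by simp; ring⟩
    rintro ⟨x, k | k⟩
    · cases k using Fin.cases with
      | zero =>
        cases x using Fin.addCases with
        | left i => exact ⟨Sum.inl (Sum.inl i), rfl⟩
        | right i => exact ⟨Sum.inr (finSumFinEquiv (Sum.inl i)), by simp [E]⟩
      | succ k => exact ⟨Sum.inr (finSumFinEquiv (Sum.inr (G (x, k)))),
          by simp [E]⟩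
    · exact ⟨Sum.inl (Sum.inr (G (x, k))), by simp [E]⟩
  let T : (Fin n ⊕ Fin ((n + j) * m)) ⊕ Fin (j + (n + j) * m) ≃
      Fin (n + (n + j) * m + (j + (n + j) * m)) :=
    (Equiv.sumCongr finSumFinEquiv (Equiv.refl _)).trans finSumFinEquiv
  refine ⟨(n + j) * m, j + (n + j) * m, (Equiv.ofBijective E hE).symm.trans T, fun x => ?_⟩
  apply EquivLike.injective (φ _)
  rw [apply_blockDiag]
  ext a b
  obtain ⟨a, rfl⟩ := T.surjective a
  obtain ⟨b, rfl⟩ := T.surjective b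
  simp only [Matrix.submatrix_apply, Equiv.symm_trans_apply, Equiv.symm_symm,
    Equiv.symm_apply_apply, Equiv.ofBijective_apply]
  rcases a with (a | a) | a <;> rcases b with (b | b) | b
  all_goals
    simp only [T, Equiv.trans_apply, Equiv.sumCongr_apply, Sum.map_inl, Sum.map_inr, apply_oplus,
      Matrix.fromBlocks_apply₁₁, Matrix.fromBlocks_apply₁₂, Matrix.fromBlocks_apply₂₁,
      Matrix.fromBlocks_apply₂₂, Matrix.zero_apply]
  all_goals
    try obtain ⟨a, rfl⟩ := G.surjective a
    try obtain ⟨b, rfl⟩ := G.surjective b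
    try obtain ⟨a | a, rfl⟩ := finSumFinEquiv.surjective a
    try obtain ⟨a', rfl⟩ := G.surjective a
    try obtain ⟨b | b, rfl⟩ := finSumFinEquiv.surjective b
    try obtain ⟨b', rfl⟩ := G.surjective b
  all_goals
    simp [E, stabBlocks, Matrix.blockDiagonal_apply]
  · exact apply_oplus x (0 : B j) (.inl a) (.inl b)
  · exact apply_oplus x (0 : B j) (.inl a) (.inr b)
  · exact fun h => absurd h.symm (Fin.succ_ne_zero _)
  · by_cases h : a = b
    · subst h
      rw [if_pos rfl, Matrix.one_apply_eq, Matrix.one_apply_eq]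
    · rw [Matrix.one_apply_ne (G.injective.ne h), ite_eq_right_iff]
      exact fun h2 => Matrix.one_apply_ne fun h1 => h (Prod.ext h1 h2)
  · exact apply_oplus x (0 : B j) (.inr a) (.inl b)
  · exact (apply_oplus x (0 : B j) (.inr a) (.inr b)).trans (by simp)
  · exact fun h => absurd h.symm (Fin.succ_ne_zero _)

end Swindle

/-- A continuous path on `[0, 1]` can be sampled at finitely many points with small increments. -/
lemma exists_sampling {X : Type*} [PseudoMetricSpace X] {g : ℝ → X}
    (hg : ContinuousOn g (Set.Icc (0 : ℝ) 1)) {ε : ℝ} (hε : 0 < ε) :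
    ∃ m : ℕ, 0 < m ∧ ∀ i : ℕ, i < m → dist (g (i / m)) (g ((i + 1 : ℕ) / m)) < ε := by
  obtain ⟨δ, hδ, h⟩ := Metric.uniformContinuousOn_iff.1
    (isCompact_Icc.uniformContinuousOn_of_continuous hg) ε hε
  obtain ⟨m, hm⟩ := exists_nat_one_div_lt hδ
  refine ⟨m + 1, m.succ_pos, fun i hi => ?_⟩
  have hm0 : (0 : ℝ) < (m + 1 : ℕ) := by positivity
  have hi' : ((i + 1 : ℕ) : ℝ) ≤ (m + 1 : ℕ) := by exact_mod_cast hi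
  have hle : (i : ℝ) ≤ (i + 1 : ℕ) := by simp
  refine h _ ⟨by positivity, (div_le_one hm0).2 (hle.trans hi')⟩ _
    ⟨by positivity, (div_le_one hm0).2 hi'⟩ ?_
  rw [Real.dist_eq, ← sub_div]
  push_cast
  rw [sub_add_cancel_left, abs_div, abs_neg, abs_one, abs_of_pos (by positivity)]
  exact hm

/-- projections homotopic in `P^L(A)` are, after stabilization by
`I_k ⊕ 0_l`, unitarily equivalent by a unitary `w ∈ U^{1635L}_{n+k+l}(A)` which is joined to
the identity by a norm-continuous path of unitaries inside `U^{2087L}_{n+k+l}(A)`. -/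
theorem stmt11 (φ : ∀ n, B n ≃⋆ₐ[ℂ] Matrix (Fin n) (Fin n) A)
    (𝓕 : LipschitzFiltration A B φ) {n : ℕ} (L : ℝ≥0) (p q : B n)
    (hp : PMem φ 𝓕 L p) (hq : PMem φ 𝓕 L q)
    (hhom : ∃ (j : ℕ) (g : ℝ → B (n + j)), ContinuousOn g (Set.Icc (0 : ℝ) 1) ∧
      g 0 = oplus φ p (0 : B j) ∧ g 1 = oplus φ q (0 : B j) ∧
      ∀ t ∈ Set.Icc (0 : ℝ) 1, PMem φ 𝓕 L (g t)) :
    ∃ (k l : ℕ) (w : B (n + k + l)),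
      UMem φ 𝓕 (1635 * L) w ∧
      oplus φ (oplus φ p (1 : B k)) (0 : B l) =
        w * oplus φ (oplus φ q (1 : B k)) (0 : B l) * star w ∧
      ∃ g : ℝ → B (n + k + l), ContinuousOn g (Set.Icc (0 : ℝ) 1) ∧
        g 0 = 1 ∧ g 1 = w ∧
        ∀ t ∈ Set.Icc (0 : ℝ) 1, UMem φ 𝓕 (2087 * L) (g t) := by
  obtain ⟨j, g, hg, hg0, hg1, hgP⟩ := hhom
  obtain ⟨m, hm, hclose⟩ := exists_sampling hg (ε := 1 / 2) (by norm_num)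
  have hm0 : (0 : ℝ) < m := by exact_mod_cast hm
  obtain ⟨k, l, e, he⟩ := exists_blockDiag_stabBlocks_eq φ n j m
  have key := isPathConj_stabBlocks (𝓕 := 𝓕) (e := e) (L := L)
    (P := fun i : Fin (m + 1) => g ((i : ℕ) / m))
    (fun i => hgP _ ⟨by positivity, (div_le_one hm0).2 (by exact_mod_cast i.is_le)⟩)
    (fun i => by simpa [dist_eq_norm] using (hclose i i.is_lt).le)
  simp only [Fin.val_zero, Nat.cast_zero, zero_div, Fin.val_last, div_self hm0.ne', hg0, hg1,
    he] at key
  obtain ⟨γ, hγ, hγ0, hγu, hpq⟩ := key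
  have hmono : ∀ {c : ℝ≥0}, 34 ≤ c → ∀ t, UMem φ 𝓕 (c * L) (γ t) := fun hc t =>
    ⟨𝓕.matMem_mono (by gcongr) (hγu t).1, (hγu t).2⟩
  exact ⟨k, l, γ 1, hmono (by norm_num) 1, hpq, γ, hγ.continuousOn, hγ0, rfl,
    fun t _ => hmono (by norm_num) t⟩
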